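/- If β ∈ B₃ is such that ρ₃(β) is a diagonal matrix over ℤ[t,t⁻¹] (both off-diagonal entries are the zero Laurent polynomial), then β is an integer power of (σ₁σ₂)³. -/

import Mathlib

open Matrix LaurentPolynomial
open scoped MatrixGroups

noncomputable section

/-- The braid relation σ₁σ₂σ₁ = σ₂σ₁σ₂ as a relator in the free group on two generators. -/
def braidRel : Set (FreeGroup (Fin 2)) :=
  {FreeGroup.of 0 * FreeGroup.of 1 * FreeGroup.of 0 *
    (FreeGroup.of 1 * FreeGroup.of 0 * FreeGroup.of 1)⁻¹}

/-- The braid group B₃ on three strands. -/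
abbrev B3 : Type := PresentedGroup braidRel

/-- The first Artin generator σ₁ of B₃. -/
def σ₁ : B3 := PresentedGroup.of 0

/-- The second Artin generator σ₂ of B₃. -/
def σ₂ : B3 := PresentedGroup.of 1
/-- The ring ℤ[t,t⁻¹] of integer Laurent polynomials. -/
abbrev Laur := LaurentPolynomial ℤ

theorem σ₁_mul_σ₂_mul_σ₁ : σ₁ * σ₂ * σ₁ = σ₂ * σ₁ * σ₂ := by
  have h : PresentedGroup.mk braidRel (FreeGroup.of 0 * FreeGroup.of 1 * FreeGroup.of 0 *
      (FreeGroup.of 1 * FreeGroup.of 0 * FreeGroup.of 1)⁻¹) = 1 :=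
    PresentedGroup.one_of_mem rfl
  rwa [map_mul, map_inv, mul_inv_eq_one] at h

/-- The central element (σ₁σ₂)³ of B₃. -/
def fullTwist : B3 := (σ₁ * σ₂) ^ 3

/-- The half twist σ₁σ₂σ₁ of B₃, a square root of the full twist. -/
def halfTwist : B3 := σ₁ * σ₂ * σ₁

theorem halfTwist_mul_σ₁ : halfTwist * σ₁ = σ₂ * halfTwist := by
  conv_rhs => rw [halfTwist, ← mul_assoc, ← mul_assoc, ← σ₁_mul_σ₂_mul_σ₁]
  rfl

theorem halfTwist_mul_σ₂ : halfTwist * σ₂ = σ₁ * halfTwist := by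
  conv_rhs => rw [halfTwist, σ₁_mul_σ₂_mul_σ₁]
  simp only [halfTwist, mul_assoc]

theorem halfTwist_mul_halfTwist : halfTwist * halfTwist = fullTwist := by
  calc halfTwist * halfTwist = σ₁ * σ₂ * (σ₁ * halfTwist) := mul_assoc _ _ _
    _ = fullTwist := by
      rw [← halfTwist_mul_σ₂]
      simp only [halfTwist, fullTwist, pow_succ, pow_zero, one_mul, mul_assoc]

theorem fullTwist_mul_σ₁ : fullTwist * σ₁ = σ₁ * fullTwist := by
  rw [← halfTwist_mul_halfTwist, mul_assoc, halfTwist_mul_σ₁, ← mul_assoc, halfTwist_mul_σ₂,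
    mul_assoc]

theorem fullTwist_mul_σ₂ : fullTwist * σ₂ = σ₂ * fullTwist := by
  rw [← halfTwist_mul_halfTwist, mul_assoc, halfTwist_mul_σ₂, ← mul_assoc, halfTwist_mul_σ₁,
    mul_assoc]

theorem closure_generators : Subgroup.closure {σ₁, σ₂} = (⊤ : Subgroup B3) := by
  rw [← PresentedGroup.closure_range_of braidRel]
  congr 1
  ext x
  simp [σ₁, σ₂, Fin.exists_fin_two, eq_comm]

theorem fullTwist_mem_center : fullTwist ∈ Subgroup.center B3 := by
  rw [← Subgroup.centralizer_univ, ← Subgroup.coe_top, ← closure_generators,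
    Subgroup.centralizer_closure, Subgroup.mem_centralizer_iff]
  rintro g (rfl | rfl)
  exacts [fullTwist_mul_σ₁.symm, fullTwist_mul_σ₂.symm]

theorem fullTwist_zpow_mul_comm (k : ℤ) (g : B3) : fullTwist ^ k * g = g * fullTwist ^ k :=
  (Subgroup.mem_center_iff.mp (zpow_mem fullTwist_mem_center k) g).symm

/-- The monoid generated by σ₁⁻¹ and σ₂. -/
def alternatingMonoid : Submonoid B3 := Submonoid.closure {σ₁⁻¹, σ₂}

/-- Braids of the form `z ^ k * (σ₁σ₂) ^ i * m * Δ ^ e` with `z` the full twist, `Δ` the half twist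
and `m` a word in σ₁⁻¹ and σ₂. -/
def HasNormalForm (g : B3) : Prop :=
  ∃ k : ℤ, ∃ i < 3, ∃ m ∈ alternatingMonoid, ∃ e < 2,
    g = fullTwist ^ k * ((σ₁ * σ₂) ^ i * m * halfTwist ^ e)

theorem hasNormalForm_one : HasNormalForm 1 :=
  ⟨0, 0, by norm_num, 1, one_mem _, 0, by norm_num, by simp⟩

theorem HasNormalForm.zpow_mul {g : B3} (hg : HasNormalForm g) (j : ℤ) :
    HasNormalForm (fullTwist ^ j * g) := by
  obtain ⟨k, i, hi, m, hm, e, he, rfl⟩ := hg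
  exact ⟨j + k, i, hi, m, hm, e, he, by rw [_root_.zpow_add, mul_assoc (fullTwist ^ j)]⟩

theorem HasNormalForm.σ₁_mul_σ₂_mul {g : B3} (hg : HasNormalForm g) :
    HasNormalForm (σ₁ * σ₂ * g) := by
  obtain ⟨k, i, hi, m, hm, e, he, rfl⟩ := hg
  rw [← mul_assoc, ← fullTwist_zpow_mul_comm, mul_assoc]
  refine HasNormalForm.zpow_mul ?_ k
  by_cases hi' : i + 1 < 3
  · exact ⟨0, i + 1, hi', m, hm, e, he, by simp only [pow_succ', zpow_zero, one_mul, mul_assoc]⟩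
  · obtain rfl : i = 2 := by omega
    exact ⟨1, 0, by norm_num, m, hm, e, he, by
      simp only [fullTwist, pow_succ, pow_zero, zpow_one, one_mul, mul_assoc]⟩

theorem halfTwist_mul_σ₁_inv : halfTwist * σ₁⁻¹ = σ₁ * σ₂ := by
  simp [halfTwist]

theorem halfTwist_mul_σ₁_mul_σ₂ : halfTwist * (σ₁ * σ₂) = fullTwist * σ₁⁻¹ := by
  rw [← halfTwist_mul_σ₁_inv, ← mul_assoc, halfTwist_mul_halfTwist]

theorem halfTwist_mul_σ₂_eq_sq : halfTwist * σ₂ = (σ₁ * σ₂) ^ 2 := by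
  simp only [halfTwist, sq, mul_assoc]

theorem halfTwist_mul_sq : halfTwist * (σ₁ * σ₂) ^ 2 = fullTwist * σ₂ := by
  rw [← halfTwist_mul_σ₂_eq_sq, ← mul_assoc, halfTwist_mul_halfTwist]

theorem σ₁_inv_mem_alternatingMonoid : σ₁⁻¹ ∈ alternatingMonoid :=
  Submonoid.subset_closure (by simp)

theorem σ₂_mem_alternatingMonoid : σ₂ ∈ alternatingMonoid :=
  Submonoid.subset_closure (by simp)

theorem hasNormalForm_halfTwist_mul_mul_pow {m : B3} (hm : m ∈ alternatingMonoid) {e : ℕ}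
    (he : e < 2) : HasNormalForm (halfTwist * (m * halfTwist ^ e)) := by
  induction hm using Submonoid.closure_induction_left with
  | one =>
    interval_cases e
    · exact ⟨0, 0, by norm_num, 1, one_mem _, 1, by norm_num, by simp⟩
    · exact ⟨1, 0, by norm_num, 1, one_mem _, 0, by norm_num, by simp [halfTwist_mul_halfTwist]⟩
  | mul_left x hx y hy _ =>
    rcases hx with rfl | rfl
    · exact ⟨0, 1, by norm_num, y, hy, e, he, by
        simp only [← mul_assoc, halfTwist_mul_σ₁_inv, zpow_zero, one_mul, pow_one]⟩
    · exact ⟨0, 2, by norm_num, y, hy, e, he, by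
        rw [← mul_assoc, ← mul_assoc, halfTwist_mul_σ₂_eq_sq, zpow_zero, one_mul]⟩

theorem HasNormalForm.halfTwist_mul {g : B3} (hg : HasNormalForm g) :
    HasNormalForm (halfTwist * g) := by
  obtain ⟨k, i, hi, m, hm, e, he, rfl⟩ := hg
  rw [← mul_assoc, ← fullTwist_zpow_mul_comm, mul_assoc]
  refine HasNormalForm.zpow_mul ?_ k
  interval_cases i
  · simpa using hasNormalForm_halfTwist_mul_mul_pow hm he
  · exact ⟨1, 0, by norm_num, _, mul_mem σ₁_inv_mem_alternatingMonoid hm, e, he, by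
      rw [pow_one, ← mul_assoc, ← mul_assoc, halfTwist_mul_σ₁_mul_σ₂]
      simp only [zpow_one, pow_zero, one_mul, mul_assoc]⟩
  · exact ⟨1, 0, by norm_num, _, mul_mem σ₂_mem_alternatingMonoid hm, e, he, by
      rw [← mul_assoc, ← mul_assoc, halfTwist_mul_sq]
      simp only [zpow_one, pow_zero, one_mul, mul_assoc]⟩

theorem HasNormalForm.σ₁_inv_mul {g : B3} (hg : HasNormalForm g) : HasNormalForm (σ₁⁻¹ * g) := by
  have h := hg.σ₁_mul_σ₂_mul.halfTwist_mul.zpow_mul (-1)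
  rwa [← mul_assoc halfTwist, halfTwist_mul_σ₁_mul_σ₂, _root_.zpow_neg_one, mul_assoc fullTwist,
    inv_mul_cancel_left] at h

theorem HasNormalForm.σ₂_mul {g : B3} (hg : HasNormalForm g) : HasNormalForm (σ₂ * g) := by
  have h := hg.σ₁_mul_σ₂_mul.σ₁_mul_σ₂_mul.halfTwist_mul.zpow_mul (-1)
  rwa [← mul_assoc (σ₁ * σ₂), ← sq, ← mul_assoc halfTwist, halfTwist_mul_sq, _root_.zpow_neg_one,
    mul_assoc fullTwist, inv_mul_cancel_left] at h

theorem HasNormalForm.σ₁_mul {g : B3} (hg : HasNormalForm g) : HasNormalForm (σ₁ * g) := by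
  have h := hg.halfTwist_mul.σ₁_mul_σ₂_mul.σ₁_mul_σ₂_mul.zpow_mul (-1)
  have key : σ₁ * σ₂ * (σ₁ * σ₂) * halfTwist = fullTwist * σ₁ := by
    simp only [fullTwist, halfTwist, pow_succ, pow_zero, one_mul, mul_assoc]
  rwa [← mul_assoc (σ₁ * σ₂), ← mul_assoc (σ₁ * σ₂ * (σ₁ * σ₂)), key, _root_.zpow_neg_one,
    mul_assoc fullTwist, inv_mul_cancel_left] at h

theorem HasNormalForm.σ₂_inv_mul {g : B3} (hg : HasNormalForm g) : HasNormalForm (σ₂⁻¹ * g) := by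
  have h := hg.halfTwist_mul.σ₁_mul_σ₂_mul.zpow_mul (-1)
  have key : fullTwist⁻¹ * (σ₁ * σ₂ * halfTwist) = σ₂⁻¹ := by
    rw [eq_inv_iff_mul_eq_one, mul_assoc, mul_assoc, halfTwist_mul_σ₂, inv_mul_eq_one,
      ← halfTwist_mul_halfTwist]
    simp only [halfTwist, mul_assoc]
  rwa [← mul_assoc (σ₁ * σ₂), ← mul_assoc, _root_.zpow_neg_one, key] at h

theorem hasNormalForm (g : B3) : HasNormalForm g := by
  have hg : g ∈ Subgroup.closure {σ₁, σ₂} := closure_generators ▸ Subgroup.mem_top g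
  induction hg using Subgroup.closure_induction_left with
  | one => exact hasNormalForm_one
  | mul_left x hx y _ hy =>
    rcases hx with rfl | rfl
    exacts [hy.σ₁_mul, hy.σ₂_mul]
  | inv_mul_cancel x hx y _ hy =>
    rcases hx with rfl | rfl
    exacts [hy.σ₁_inv_mul, hy.σ₂_inv_mul]

section SpecializationAtNegOne

variable {f : B3 →* Matrix (Fin 2) (Fin 2) ℤ}

theorem map_σ₁_inv (hf₁ : f σ₁ = !![1, 1; 0, 1]) : f σ₁⁻¹ = !![1, -1; 0, 1] := by
  have h : f σ₁⁻¹ * f σ₁ = 1 := by rw [← map_mul, inv_mul_cancel, map_one]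
  calc f σ₁⁻¹ = f σ₁⁻¹ * (f σ₁ * !![1, -1; 0, 1]) := by
        simp [hf₁, ← Matrix.one_fin_two]
    _ = !![1, -1; 0, 1] := by rw [← mul_assoc, h, one_mul]

theorem map_σ₁_mul_σ₂ (hf₁ : f σ₁ = !![1, 1; 0, 1]) (hf₂ : f σ₂ = !![1, 0; -1, 1]) :
    f (σ₁ * σ₂) = !![0, 1; -1, 1] := by
  simp [hf₁, hf₂]

theorem map_halfTwist (hf₁ : f σ₁ = !![1, 1; 0, 1]) (hf₂ : f σ₂ = !![1, 0; -1, 1]) :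
    f halfTwist = !![0, 1; -1, 0] := by
  simp [halfTwist, hf₁, hf₂]

theorem map_fullTwist (hf₁ : f σ₁ = !![1, 1; 0, 1]) (hf₂ : f σ₂ = !![1, 0; -1, 1]) :
    f fullTwist = -1 := by
  rw [← halfTwist_mul_halfTwist, map_mul, map_halfTwist hf₁ hf₂]
  simp [Matrix.one_fin_two]

theorem map_fullTwist_zpow (hf₁ : f σ₁ = !![1, 1; 0, 1]) (hf₂ : f σ₂ = !![1, 0; -1, 1]) (k : ℤ) :
    f (fullTwist ^ k) = 1 ∨ f (fullTwist ^ k) = -1 := by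
  have hz : f.toHomUnits fullTwist = -1 := Units.ext (map_fullTwist hf₁ hf₂)
  rw [← MonoidHom.coe_toHomUnits, map_zpow, hz]
  rcases Int.even_or_odd' k with ⟨j, rfl | rfl⟩
  · left; simp [_root_.zpow_mul]
  · right; simp [_root_.zpow_mul, _root_.zpow_add]

/-- Nontrivial words in σ₁⁻¹ and σ₂ have matrices at `t = -1` whose off-diagonal entries are
nonpositive and not both zero. -/
theorem map_alternatingMonoid (hf₁ : f σ₁ = !![1, 1; 0, 1]) (hf₂ : f σ₂ = !![1, 0; -1, 1])
    {m : B3} (hm : m ∈ alternatingMonoid) :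
    0 < f m 0 0 ∧ f m 0 1 ≤ 0 ∧ f m 1 0 ≤ 0 ∧ 0 < f m 1 1 ∧
      (m = 1 ∨ f m 0 1 + f m 1 0 < 0) := by
  induction hm using Submonoid.closure_induction_left with
  | one => simp
  | mul_left x hx y _ ih =>
    obtain ⟨h00, h01, h10, h11, -⟩ := ih
    rcases hx with rfl | rfl
    · simp only [map_mul, map_σ₁_inv hf₁, Matrix.mul_apply, Fin.sum_univ_two, Matrix.of_apply,
        Matrix.cons_val', Matrix.cons_val_zero, Matrix.cons_val_one, Matrix.cons_val_fin_one]
      refine ⟨?_, ?_, ?_, ?_, Or.inr ?_⟩ <;> linarith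
    · simp only [map_mul, hf₂, Matrix.mul_apply, Fin.sum_univ_two, Matrix.of_apply,
        Matrix.cons_val', Matrix.cons_val_zero, Matrix.cons_val_one, Matrix.cons_val_fin_one]
      refine ⟨?_, ?_, ?_, ?_, Or.inr ?_⟩ <;> linarith

theorem eq_fullTwist_zpow_of_map_diagonal (hf₁ : f σ₁ = !![1, 1; 0, 1])
    (hf₂ : f σ₂ = !![1, 0; -1, 1]) {g : B3} (h01 : f g 0 1 = 0) (h10 : f g 1 0 = 0) :
    ∃ k : ℤ, g = fullTwist ^ k := by
  obtain ⟨k, i, hi, m, hm, e, he, rfl⟩ := hasNormalForm g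
  obtain ⟨m00, m01, m10, m11, hm1⟩ := map_alternatingMonoid hf₁ hf₂ hm
  replace h01 : f ((σ₁ * σ₂) ^ i * m * halfTwist ^ e) 0 1 = 0 := by
    rw [map_mul] at h01
    rcases map_fullTwist_zpow hf₁ hf₂ k with h | h <;> simpa [h] using h01
  replace h10 : f ((σ₁ * σ₂) ^ i * m * halfTwist ^ e) 1 0 = 0 := by
    rw [map_mul] at h10
    rcases map_fullTwist_zpow hf₁ hf₂ k with h | h <;> simpa [h] using h10
  rw [map_mul, map_mul, map_pow, map_pow, map_σ₁_mul_σ₂ hf₁ hf₂, map_halfTwist hf₁ hf₂] at h01 h10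
  interval_cases i <;> interval_cases e <;>
    simp [Matrix.mul_apply, Matrix.vecMul, dotProduct, Fin.sum_univ_two, sq] at h01 h10
  · rcases hm1 with rfl | h
    · exact ⟨k, by simp⟩
    · linarith
  all_goals exfalso; linarith

end SpecializationAtNegOne

/-- **Diagonal Burau matrices.** If ρ₃(β) is a diagonal matrix over ℤ[t,t⁻¹] (both
off-diagonal entries are the zero Laurent polynomial), then β is an integer power of
(σ₁σ₂)³ (the variable t is `T 1`). -/
theorem burau_diagonal_imp_central_power (ρ : B3 →* GL (Fin 2) Laur)
    (hρ₁ : (ρ σ₁ : Matrix (Fin 2) (Fin 2) Laur) = !![-T 1, 1; 0, 1])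
    (hρ₂ : (ρ σ₂ : Matrix (Fin 2) (Fin 2) Laur) = !![1, 0; T 1, -T 1])
    (β : B3)
    (h01 : (ρ β : Matrix (Fin 2) (Fin 2) Laur) 0 1 = 0)
    (h10 : (ρ β : Matrix (Fin 2) (Fin 2) Laur) 1 0 = 0) :
    ∃ k : ℤ, β = ((σ₁ * σ₂) ^ 3) ^ k := by
  let φ : Laur →+* ℤ := LaurentPolynomial.eval₂ (RingHom.id ℤ) (-1)
  have hφ : φ (T 1) = -1 := by simp [φ, LaurentPolynomial.eval₂_T]
  let f : B3 →* Matrix (Fin 2) (Fin 2) ℤ :=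
    φ.mapMatrix.toMonoidHom.comp ((Units.coeHom _).comp ρ)
  have hf (g : B3) (i j : Fin 2) : f g i j = φ ((ρ g : Matrix (Fin 2) (Fin 2) Laur) i j) := rfl
  refine eq_fullTwist_zpow_of_map_diagonal (f := f) ?_ ?_ ?_ ?_
  · ext i j
    fin_cases i <;> fin_cases j <;> simp [hf, hρ₁, hφ]
  · ext i j
    fin_cases i <;> fin_cases j <;> simp [hf, hρ₂, hφ]
  · rw [hf, h01, map_zero]
  · rw [hf, h10, map_zero]
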